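/- arXiv:2002.00719 — 2 statements merged into one kernel-verified Lean document; each statement's English description precedes it below -/
import Mathlib

section
/- Let (X,d) be a δ-hyperbolic geodesic space and n a positive integer. If a ≥ 0, b ≥ 1, and there is a map φ : C_{2n} → X from the cycle graph of length 2n satisfying a·d_{C_{2n}}(x,y) ≤ d(φ(x),φ(y)) ≤ b·d_{C_{2n}}(x,y) for all x,y ∈ C_{2n}, then a ≤ (4δ·log₂(bn) + 4 + 2b)/n. -/
/-- `g` is a geodesic parametrization of a geodesic segment from `x` to `y`. -/
def IsGeodesicFrom {X : Type*} [MetricSpace X] (g : ℝ → X) (x y : X) : Prop :=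
  g 0 = x ∧ g (dist x y) = y ∧
    ∀ s ∈ Set.Icc (0 : ℝ) (dist x y), ∀ t ∈ Set.Icc (0 : ℝ) (dist x y),
      dist (g s) (g t) = |s - t|

/-- `X` is a geodesic metric space. -/
def GeodesicSpace (X : Type*) [MetricSpace X] : Prop :=
  ∀ x y : X, ∃ g : ℝ → X, IsGeodesicFrom g x y

/-- Rips condition: every side of every geodesic triangle lies in the `δ`-neighbourhood
of the union of the other two sides. -/
def RipsHyperbolic (X : Type*) [MetricSpace X] (δ : ℝ) : Prop :=
  ∀ x y z : X, ∀ gxy gxz gyz : ℝ → X,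
    IsGeodesicFrom gxy x y → IsGeodesicFrom gxz x z → IsGeodesicFrom gyz y z →
    ∀ p ∈ gxy '' Set.Icc (0 : ℝ) (dist x y),
      Metric.infDist p
        (gxz '' Set.Icc (0 : ℝ) (dist x z) ∪ gyz '' Set.Icc (0 : ℝ) (dist y z)) ≤ δ

/-- The graph metric on the cycle `C_m = Cayley(ℤ/mℤ, {±1})`. -/
noncomputable def cycleDist {m : ℕ} (x y : ZMod m) : ℕ :=
  sInf {k : ℕ | (k : ZMod m) = y - x ∨ (k : ZMod m) = x - y}

lemma geod_cont {X : Type*} [MetricSpace X] {g : ℝ → X} {x y : X} (h : IsGeodesicFrom g x y) :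
    ContinuousOn g (Set.Icc (0 : ℝ) (dist x y)) := by
  have : LipschitzOnWith 1 g (Set.Icc (0 : ℝ) (dist x y)) := by
    apply LipschitzOnWith.of_dist_le_mul
    intro s hs t ht
    rw [h.2.2 s hs t ht, Real.dist_eq]
    simp
  exact this.continuousOn

lemma rips_pt {X : Type*} [MetricSpace X] {δ : ℝ} (hhyp : RipsHyperbolic X δ)
    {x y z : X} {gxy gxz gyz : ℝ → X}
    (h1 : IsGeodesicFrom gxy x y) (h2 : IsGeodesicFrom gxz x z) (h3 : IsGeodesicFrom gyz y z)
    {p : X} (hp : p ∈ gxy '' Set.Icc (0 : ℝ) (dist x y)) :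
    ∃ q, (q ∈ gxz '' Set.Icc (0 : ℝ) (dist x z) ∨ q ∈ gyz '' Set.Icc (0 : ℝ) (dist y z)) ∧
      dist p q ≤ δ := by
  have h := hhyp x y z gxy gxz gyz h1 h2 h3 p hp
  have hc : IsCompact (gxz '' Set.Icc (0 : ℝ) (dist x z) ∪ gyz '' Set.Icc (0 : ℝ) (dist y z)) :=
    (isCompact_Icc.image_of_continuousOn (geod_cont h2)).union
      (isCompact_Icc.image_of_continuousOn (geod_cont h3))
  have hne : (gxz '' Set.Icc (0 : ℝ) (dist x z) ∪
      gyz '' Set.Icc (0 : ℝ) (dist y z)).Nonempty :=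
    ⟨gxz 0, Or.inl ⟨0, ⟨le_refl _, dist_nonneg⟩, rfl⟩⟩
  obtain ⟨q, hq, hd⟩ := hc.exists_infDist_eq_dist hne p
  exact ⟨q, hq, hd ▸ h⟩

lemma subdiv {X : Type*} [MetricSpace X] {δ : ℝ}
    (hgeo : GeodesicSpace X) (hhyp : RipsHyperbolic X δ) {b n : ℝ}
    (f : ℝ → X) (hf : ∀ s t, dist (f s) (f t) ≤ b * |s - t|) (N : ℕ) :
    ∀ u ∈ Set.Icc 0 n, ∀ v ∈ Set.Icc 0 n, ∀ g, IsGeodesicFrom g (f u) (f v) →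
      ∀ p ∈ g '' Set.Icc (0 : ℝ) (dist (f u) (f v)),
      ∃ t ∈ Set.Icc 0 n, dist p (f t) ≤ δ * N + b * |u - v| / 2 ^ N / 2 := by
  induction N with
  | zero =>
    rintro u hu v hv g hg p ⟨s, hs, rfl⟩
    have h0 := hg.2.2 s hs 0 ⟨le_refl _, dist_nonneg⟩
    have h1 := hg.2.2 s hs _ ⟨dist_nonneg, le_refl _⟩
    rw [hg.1, sub_zero, abs_of_nonneg hs.1] at h0
    rw [hg.2.1, abs_of_nonpos (by linarith [hs.2])] at h1
    have := hf u v
    rcases le_total s (dist (f u) (f v) / 2) with h | h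
    · exact ⟨u, hu, by simp; linarith⟩
    · exact ⟨v, hv, by simp; linarith⟩
  | succ N ih =>
    intro u hu v hv g hg p hp
    have hw : (u + v) / 2 ∈ Set.Icc 0 n :=
      ⟨by linarith [hu.1, hv.1], by linarith [hu.2, hv.2]⟩
    obtain ⟨g1, hg1⟩ := hgeo (f u) (f ((u + v) / 2))
    obtain ⟨g2, hg2⟩ := hgeo (f v) (f ((u + v) / 2))
    obtain ⟨q, hq, hpq⟩ := rips_pt hhyp hg hg1 hg2 hp
    have e1 : |u - (u + v) / 2| = |u - v| / 2 := by
      rw [show u - (u + v) / 2 = (u - v) / 2 by ring, abs_div]; simp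
    have e2 : |v - (u + v) / 2| = |u - v| / 2 := by
      rw [show v - (u + v) / 2 = (v - u) / 2 by ring, abs_div, abs_sub_comm]; simp
    have e3 : b * (|u - v| / 2) / 2 ^ N / 2 = b * |u - v| / 2 ^ (N + 1) / 2 := by
      rw [pow_succ]; field_simp
    rcases hq with hq | hq
    · obtain ⟨t, ht, h⟩ := ih u hu _ hw g1 hg1 q hq
      rw [e1, e3] at h
      refine ⟨t, ht, ?_⟩
      push_cast
      linarith [dist_triangle p q (f t)]
    · obtain ⟨t, ht, h⟩ := ih v hv _ hw g2 hg2 q hq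
      rw [e2, e3] at h
      refine ⟨t, ht, ?_⟩
      push_cast
      linarith [dist_triangle p q (f t)]

lemma interp {X : Type*} [MetricSpace X] (hgeo : GeodesicSpace X) {b : ℝ} (hb : 0 ≤ b)
    (ψ : ℤ → X) (hψ : ∀ i j : ℤ, dist (ψ i) (ψ j) ≤ b * |(i : ℝ) - j|) :
    ∃ f : ℝ → X, (∀ i : ℤ, f i = ψ i) ∧ ∀ s t, dist (f s) (f t) ≤ b * |s - t| := by
  choose g hg using fun i : ℤ => hgeo (ψ i) (ψ (i + 1))
  have hd : ∀ i : ℤ, dist (ψ i) (ψ (i + 1)) ≤ b := by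
    intro i
    simpa using hψ i (i + 1)
  let f : ℝ → X := fun t => g ⌊t⌋ (Int.fract t * dist (ψ ⌊t⌋) (ψ (⌊t⌋ + 1)))
  have hf : ∀ t, f t = g ⌊t⌋ (Int.fract t * dist (ψ ⌊t⌋) (ψ (⌊t⌋ + 1))) := fun t => rfl
  have hmem : ∀ t : ℝ, ∀ D : ℝ, 0 ≤ D → Int.fract t * D ∈ Set.Icc 0 D := fun t D hD =>
    ⟨mul_nonneg (Int.fract_nonneg t) hD,
      mul_le_of_le_one_left hD (Int.fract_lt_one t).le⟩
  have hi : ∀ i : ℤ, f i = ψ i := by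
    intro i
    rw [hf]
    simp [(hg i).1]
  have hl : ∀ t, dist (f t) (ψ ⌊t⌋) ≤ b * (t - ⌊t⌋) := by
    intro t
    have h := (hg ⌊t⌋).2.2 _ (hmem t _ dist_nonneg) 0 ⟨le_refl _, dist_nonneg⟩
    rw [(hg ⌊t⌋).1, sub_zero, abs_of_nonneg (hmem t _ dist_nonneg).1, ← hf] at h
    rw [h, Int.self_sub_floor, mul_comm b]
    exact mul_le_mul_of_nonneg_left (hd _) (Int.fract_nonneg t)
  have hr : ∀ t, dist (f t) (ψ (⌊t⌋ + 1)) ≤ b * (⌊t⌋ + 1 - t) := by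
    intro t
    have h := (hg ⌊t⌋).2.2 _ (hmem t _ dist_nonneg) _ ⟨dist_nonneg, le_refl _⟩
    rw [(hg ⌊t⌋).2.1, abs_of_nonpos (by linarith [(hmem t _ (dist_nonneg
      (x := ψ ⌊t⌋) (y := ψ (⌊t⌋ + 1)))).2]), ← hf] at h
    have e : (⌊t⌋ : ℝ) + 1 - t = 1 - Int.fract t := by
      rw [← Int.self_sub_floor]; ring
    rw [h, e]
    nlinarith [hd ⌊t⌋, Int.fract_lt_one t]
  have key : ∀ s t, s ≤ t → dist (f s) (f t) ≤ b * (t - s) := by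
    intro s t hst
    rcases (Int.floor_le_floor hst).eq_or_lt with h | h
    · have h' := (hg ⌊t⌋).2.2 _ (hmem s _ dist_nonneg) _ (hmem t _ dist_nonneg)
      rw [← hf, ← sub_mul, ← h, ← hf, abs_mul, abs_of_nonneg (dist_nonneg)] at h'
      have e : Int.fract s - Int.fract t = s - t := by
        rw [← Int.self_sub_floor, ← Int.self_sub_floor, h]; ring
      rw [h', e, abs_of_nonpos (by linarith)]
      nlinarith [hd ⌊s⌋]
    · have h1 := hr s
      have h2 := hl t
      have h3 := hψ (⌊s⌋ + 1) ⌊t⌋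
      have h4 : ((⌊s⌋ + 1 : ℤ) : ℝ) ≤ ⌊t⌋ := by exact_mod_cast h
      rw [abs_of_nonpos (by linarith)] at h3
      push_cast at h3
      have h5 := dist_triangle4 (f s) (ψ (⌊s⌋ + 1)) (ψ ⌊t⌋) (f t)
      rw [dist_comm (ψ ⌊t⌋) (f t)] at h5
      nlinarith
  refine ⟨f, hi, fun s t => ?_⟩
  rcases le_total s t with h | h
  · rw [abs_of_nonpos (by linarith)]
    linarith [key s t h]
  · rw [abs_of_nonneg (by linarith), dist_comm]
    exact key t s h

lemma near_vertex {X : Type*} [MetricSpace X] {δ : ℝ} (hδ : 0 ≤ δ)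
    (hgeo : GeodesicSpace X) (hhyp : RipsHyperbolic X δ)
    (n : ℕ) (hn : 0 < n) {b : ℝ} (hb : 1 ≤ b)
    (ψ : ℤ → X) (hψ : ∀ i j : ℤ, dist (ψ i) (ψ j) ≤ b * |(i : ℝ) - j|)
    (g : ℝ → X) {x y : X} (hx : ψ 0 = x) (hy : ψ n = y) (hg : IsGeodesicFrom g x y)
    (s : ℝ) (hs : s ∈ Set.Icc (0 : ℝ) (dist x y)) :
    ∃ i : ℤ, 0 ≤ i ∧ i ≤ n ∧
      dist (g s) (ψ i) ≤ δ * Real.logb 2 (b * n) + 1 + b / 2 := by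
  subst hx hy
  obtain ⟨f, hfi, hf⟩ := interp hgeo (by linarith) ψ hψ
  have hn1 : (1 : ℝ) ≤ n := by exact_mod_cast hn
  have hbn : 1 ≤ b * n := by nlinarith
  have hlog : 0 ≤ Real.logb 2 (b * n) := Real.logb_nonneg (by norm_num) hbn
  have h0 : f 0 = ψ 0 := by simpa using hfi 0
  have hnn : f n = ψ n := by simpa using hfi n
  have hN1 := Nat.floor_le hlog
  have hN2 := Nat.lt_floor_add_one (Real.logb 2 (b * n))
  set N := ⌊Real.logb 2 (b * n)⌋₊ with hN
  obtain ⟨t, ht, h⟩ := subdiv (n := n) hgeo hhyp f hf N 0 ⟨le_refl _, by linarith⟩ n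
    ⟨by linarith, le_refl _⟩ g (by rw [h0, hnn]; exact hg) (g s)
    (by rw [h0, hnn]; exact ⟨s, hs, rfl⟩)
  rw [zero_sub, abs_neg, abs_of_nonneg (by linarith : (0 : ℝ) ≤ n)] at h
  have h2 : b * n < 2 ^ (N + 1) := by
    rw [Real.logb_lt_iff_lt_rpow (by norm_num) (by linarith)] at hN2
    exact_mod_cast hN2
  have h3 : b * n / 2 ^ N / 2 ≤ 1 := by
    rw [div_div, div_le_one (by positivity), ← pow_succ]
    exact h2.le
  have h4 : δ * N ≤ δ * Real.logb 2 (b * n) := mul_le_mul_of_nonneg_left hN1 hδ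
  have hfl := Int.floor_le t
  have hfl2 := Int.lt_floor_add_one t
  have hfl0 : 0 ≤ ⌊t⌋ := Int.floor_nonneg.2 ht.1
  suffices ∃ i : ℤ, 0 ≤ i ∧ i ≤ n ∧ dist (f t) (ψ i) ≤ b / 2 by
    obtain ⟨i, hi0, hi1, hi⟩ := this
    exact ⟨i, hi0, hi1, by linarith [dist_triangle (g s) (f t) (ψ i)]⟩
  rcases le_total (t - ⌊t⌋) (1 / 2) with hc | hc
  · refine ⟨⌊t⌋, hfl0, ?_, ?_⟩
    · have : (⌊t⌋ : ℝ) ≤ n := by linarith [ht.2]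
      exact_mod_cast this
    · rw [← hfi]
      refine (hf _ _).trans ?_
      rw [abs_of_nonneg (by linarith)]
      nlinarith
  · refine ⟨⌊t⌋ + 1, by omega, ?_, ?_⟩
    · have : (⌊t⌋ : ℝ) < n := by linarith [ht.2]
      have : ⌊t⌋ < (n : ℤ) := by exact_mod_cast this
      omega
    · rw [← hfi]
      refine (hf _ _).trans ?_
      push_cast
      rw [abs_of_nonpos (by linarith)]
      nlinarith

lemma cycleDist_le {m : ℕ} (i j : ℤ) : cycleDist (i : ZMod m) (j : ZMod m) ≤ (i - j).natAbs := by
  apply Nat.sInf_le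
  rcases Int.natAbs_eq (i - j) with h | h
  · right
    rw [← Int.cast_sub, ← Int.cast_natCast, ← h]
  · left
    rw [← Int.cast_sub, ← Int.cast_natCast]
    congr 1
    omega

lemma le_cycleDist {n : ℕ} (hn : 0 < n) (i j : ℤ) (h1 : (n : ℤ) ≤ 2 * (i + j))
    (h2 : 2 * (i + j) ≤ 3 * n) :
    n ≤ 2 * cycleDist (i : ZMod (2 * n)) ((-j : ℤ) : ZMod (2 * n)) := by
  have hne : {k : ℕ | (k : ZMod (2 * n)) = ((-j : ℤ) : ZMod (2 * n)) - (i : ZMod (2 * n)) ∨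
      (k : ZMod (2 * n)) = (i : ZMod (2 * n)) - ((-j : ℤ) : ZMod (2 * n))}.Nonempty := by
    refine ⟨(i + j).natAbs, Or.inr ?_⟩
    rw [← Int.cast_sub, ← Int.cast_natCast]
    congr 1
    omega
  have hm := Nat.sInf_mem hne
  change (cycleDist (i : ZMod (2 * n)) ((-j : ℤ) : ZMod (2 * n)) : ZMod (2 * n)) = _ ∨
    (cycleDist (i : ZMod (2 * n)) ((-j : ℤ) : ZMod (2 * n)) : ZMod (2 * n)) = _ at hm
  generalize cycleDist (i : ZMod (2 * n)) ((-j : ℤ) : ZMod (2 * n)) = k at hm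
  rw [← Int.cast_sub, ← Int.cast_sub, ← Int.cast_natCast, ZMod.intCast_eq_intCast_iff_dvd_sub,
    ZMod.intCast_eq_intCast_iff_dvd_sub] at hm
  push_cast at hm
  rcases hm with ⟨q, hq⟩ | ⟨q, hq⟩
  · have : q ≤ -1 := by
      by_contra hh
      have : 0 ≤ (n : ℤ) * q := by
        apply mul_nonneg <;> omega
      nlinarith
    have : (n : ℤ) * q ≤ n * (-1) := by
      apply mul_le_mul_of_nonneg_left this; omega
    have : (n : ℤ) ≤ 2 * k := by nlinarith
    omega
  · have : q ≤ 0 := by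
      by_contra hh
      have : (n : ℤ) * 1 ≤ (n : ℤ) * q := by
        apply mul_le_mul_of_nonneg_left <;> omega
      nlinarith
    have : (n : ℤ) * q ≤ n * 0 := by
      apply mul_le_mul_of_nonneg_left this; omega
    have : (n : ℤ) ≤ 2 * k := by nlinarith
    omega

/-- Let `(X,d)` be a `δ`-hyperbolic geodesic space and `n ≥ 1`.  If `a ≥ 0`, `b ≥ 1` and
`φ : C_{2n} → X` satisfies `a·d(x,y) ≤ d(φx,φy) ≤ b·d(x,y)` for all `x, y ∈ C_{2n}`,
then `a ≤ (4δ·log₂(bn) + 4 + 2b)/n`. -/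
theorem cycle_embedding_bound
    {X : Type*} [MetricSpace X] (δ : ℝ) (hδ : 0 ≤ δ)
    (hgeo : GeodesicSpace X) (hhyp : RipsHyperbolic X δ)
    (n : ℕ) (hn : 0 < n) (a b : ℝ) (ha : 0 ≤ a) (hb : 1 ≤ b)
    (φ : ZMod (2 * n) → X)
    (hφ : ∀ x y : ZMod (2 * n),
      a * (cycleDist x y : ℝ) ≤ dist (φ x) (φ y) ∧
      dist (φ x) (φ y) ≤ b * (cycleDist x y : ℝ)) :
    a ≤ (4 * δ * Real.logb 2 (b * n) + 4 + 2 * b) / n := by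
  set E := δ * Real.logb 2 (b * n) + 1 + b / 2 with hE
  have hn1 : (1 : ℝ) ≤ n := by exact_mod_cast hn
  have hlog : 0 ≤ Real.logb 2 (b * n) := Real.logb_nonneg (by norm_num) (by nlinarith)
  have hE0 : 0 ≤ E := by positivity
  have hup : ∀ i j : ℤ, dist (φ (i : ℤ)) (φ (j : ℤ)) ≤ b * |(i : ℝ) - j| := by
    intro i j
    refine (hφ _ _).2.trans (mul_le_mul_of_nonneg_left ?_ (by linarith))
    have h : ((cycleDist (i : ZMod (2 * n)) (j : ZMod (2 * n)) : ℕ) : ℝ) ≤ (i - j).natAbs := by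
      exact_mod_cast cycleDist_le i j
    rw [Nat.cast_natAbs] at h
    exact_mod_cast h
  have hlow : ∀ i j : ℤ, dist (φ ((-i : ℤ))) (φ ((-j : ℤ))) ≤ b * |(i : ℝ) - j| := by
    intro i j
    have h := hup (-i) (-j)
    have e : ((-i : ℤ) : ℝ) - ((-j : ℤ) : ℝ) = -((i : ℝ) - j) := by push_cast; ring
    rwa [e, abs_neg] at h
  obtain ⟨g, hg⟩ := hgeo (φ ((0 : ℤ))) (φ ((n : ℤ)))
  have hend : φ ((-(n : ℤ) : ℤ)) = φ ((n : ℤ)) := by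
    congr 1
    rw [ZMod.intCast_eq_intCast_iff_dvd_sub]
    exact ⟨1, by push_cast; ring⟩
  have hU := near_vertex hδ hgeo hhyp n hn hb (fun i : ℤ => φ (i : ℤ)) hup g rfl rfl hg
  have hL := near_vertex hδ hgeo hhyp n hn hb (fun i : ℤ => φ ((-i : ℤ))) hlow g
    (by simp) hend hg
  have main : ∃ s ∈ Set.Icc (0 : ℝ) (dist (φ ((0 : ℤ))) (φ ((n : ℤ)))),
      (∃ i : ℤ, 0 ≤ i ∧ 2 * i ≤ n ∧ dist (g s) (φ (i : ℤ)) ≤ E) ∧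
      (∃ i : ℤ, (n : ℤ) ≤ 2 * i ∧ i ≤ n ∧ dist (g s) (φ (i : ℤ)) ≤ E) := by
    have hcl : ∀ S : Finset ℤ, IsClosed (Set.Icc (0 : ℝ) (dist (φ ((0 : ℤ))) (φ ((n : ℤ)))) ∩
        g ⁻¹' (⋃ i ∈ S, Metric.closedBall (φ (i : ℤ)) E)) := by
      intro S
      apply (geod_cont hg).preimage_isClosed_of_isClosed isClosed_Icc
      exact S.finite_toSet.isClosed_biUnion fun i _ => Metric.isClosed_closedBall
    have hpc := isPreconnected_closed_iff.1
      (isPreconnected_Icc (a := (0 : ℝ)) (b := dist (φ ((0 : ℤ))) (φ ((n : ℤ)))))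
      _ _ (hcl ((Finset.Icc 0 (n : ℤ)).filter fun i => 2 * i ≤ n))
      (hcl ((Finset.Icc 0 (n : ℤ)).filter fun i => (n : ℤ) ≤ 2 * i))
    have c2 := hpc (by
      intro s hs
      obtain ⟨i, hi0, hi1, hi⟩ := hU s hs
      rcases le_total (2 * i) n with h | h
      · left
        refine ⟨hs, ?_⟩
        simp only [Set.mem_preimage, Set.mem_iUnion, Finset.mem_filter, Finset.mem_Icc,
          Metric.mem_closedBall]
        exact ⟨i, ⟨⟨hi0, hi1⟩, h⟩, hi⟩
      · right
        refine ⟨hs, ?_⟩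
        simp only [Set.mem_preimage, Set.mem_iUnion, Finset.mem_filter, Finset.mem_Icc,
          Metric.mem_closedBall]
        exact ⟨i, ⟨⟨hi0, hi1⟩, h⟩, hi⟩)
      (by
      refine ⟨0, ⟨le_refl _, dist_nonneg⟩, ⟨le_refl _, dist_nonneg⟩, ?_⟩
      simp only [Set.mem_preimage, Set.mem_iUnion, Finset.mem_filter, Finset.mem_Icc,
        Metric.mem_closedBall]
      exact ⟨0, ⟨⟨le_refl _, by omega⟩, by omega⟩, by rw [hg.1, dist_self]; exact hE0⟩)
      (by
      refine ⟨_, ⟨dist_nonneg, le_refl _⟩, ⟨dist_nonneg, le_refl _⟩, ?_⟩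
      simp only [Set.mem_preimage, Set.mem_iUnion, Finset.mem_filter, Finset.mem_Icc,
        Metric.mem_closedBall]
      exact ⟨n, ⟨⟨by omega, le_refl _⟩, by omega⟩, by rw [hg.2.1, dist_self]; exact hE0⟩)
    obtain ⟨s, hs, ⟨_, h1⟩, ⟨_, h2⟩⟩ := c2
    simp only [Set.mem_preimage, Set.mem_iUnion, Finset.mem_filter, Finset.mem_Icc,
      Metric.mem_closedBall] at h1 h2
    obtain ⟨i, ⟨⟨hi1, hi2⟩, hi3⟩, hi⟩ := h1
    obtain ⟨j, ⟨⟨hj1, hj2⟩, hj3⟩, hj⟩ := h2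
    exact ⟨s, hs, ⟨i, hi1, hi3, hi⟩, ⟨j, hj3, hj2, hj⟩⟩
  obtain ⟨s, hs, ⟨i, hi0, hi1, hi⟩, ⟨k, hk0, hk1, hk⟩⟩ := main
  obtain ⟨j, hj0, hj1, hj⟩ := hL s hs
  have fin : ∀ i : ℤ, dist (g s) (φ (i : ℤ)) ≤ E → (n : ℤ) ≤ 2 * (i + j) →
      2 * (i + j) ≤ 3 * n → a * n ≤ 4 * E := by
    intro i hi h1 h2
    have h3 := (hφ (i : ℤ) ((-j : ℤ))).1
    have h4 : (n : ℝ) ≤ 2 * (cycleDist (i : ZMod (2 * n)) ((-j : ℤ) : ZMod (2 * n)) : ℕ) := by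
      exact_mod_cast le_cycleDist hn i j h1 h2
    have h5 := dist_triangle_left (φ (i : ℤ)) (φ ((-j : ℤ))) (g s)
    have h6 := mul_le_mul_of_nonneg_left h4 ha
    linarith
  have hfin : a * n ≤ 4 * E := by
    rcases le_total (2 * j) n with h | h
    · exact fin k hk (by omega) (by omega)
    · exact fin i hi (by omega) (by omega)
  rw [le_div_iff₀ (by linarith)]
  rw [hE] at hfin
  linarith
end

section
/- Let (X,d) be a geodesic metric space that is not δ-hyperbolic for any δ (i.e. not hyperbolic). Then there exist arbitrarily large integers n and maps φₙ : Cₙ → X such that (1/17820)·d_{Cₙ}(x,y) ≤ d(φₙ(x), φₙ(y)) ≤ d_{Cₙ}(x,y) for all x,y ∈ Cₙ. -/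
namespace NHEC

open Finset

/-- A chain of `n` steps of size at most `1/3` from `p` to `q` with discrete integral
`∫ f dh` equal to `v`. -/
def Ch {X : Type*} [MetricSpace X] (f h : X → ℝ) (n : ℕ) (p q : X) (v : ℝ) : Prop :=
  ∃ x : ℕ → X, x 0 = p ∧ x n = q ∧ (∀ i < n, dist (x i) (x (i + 1)) ≤ 1 / 3) ∧
    ∑ i ∈ range n, (f (x i) + f (x (i + 1))) / 2 * (h (x (i + 1)) - h (x i)) = v

variable {X : Type*} [MetricSpace X] {f h : X → ℝ}

lemma Ch.trans {n m : ℕ} {p q r : X} {u v : ℝ} (h1 : Ch f h n p q u) (h2 : Ch f h m q r v) :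
    Ch f h (n + m) p r (u + v) := by
  obtain ⟨x, x0, xn, xs, xv⟩ := h1
  obtain ⟨y, y0, ym, ys, yv⟩ := h2
  let z : ℕ → X := fun i => if i ≤ n then x i else y (i - n)
  have z1 : ∀ i ≤ n, z i = x i := fun i hi => by simp [z, hi]
  have z2 : ∀ i, z (n + i) = y i := fun i => by
    rcases Nat.eq_zero_or_pos i with rfl | hi
    · simp [z, xn, y0]
    · have : ¬ (n + i ≤ n) := by omega
      simp [z]
      intro hh; omega
  refine ⟨z, by rw [z1 0 (by omega), x0], by rw [z2, ym], ?_, ?_⟩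
  · intro i hi
    rcases lt_or_ge i n with hin | hin
    · rw [z1 i hin.le, z1 (i + 1) hin]; exact xs i hin
    · obtain ⟨k, rfl⟩ := Nat.exists_eq_add_of_le hin
      rw [add_assoc, z2, z2]; exact ys k (by omega)
  · rw [Finset.sum_range_add, ← xv, ← yv]
    congr 1
    · apply Finset.sum_congr rfl
      intro i hi
      have := Finset.mem_range.1 hi
      rw [z1 i this.le, z1 (i + 1) this]
    · apply Finset.sum_congr rfl
      intro i hi
      rw [add_assoc, z2, z2]

lemma Ch.symm {n : ℕ} {p q : X} {u : ℝ} (h1 : Ch f h n p q u) : Ch f h n q p (-u) := by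
  obtain ⟨x, x0, xn, xs, xv⟩ := h1
  refine ⟨fun i => x (n - i), by simpa using xn, by simpa using x0, ?_, ?_⟩
  · intro i hi
    have := xs (n - (i + 1)) (by omega)
    rw [show n - (i + 1) + 1 = n - i by omega] at this
    rw [dist_comm]; exact this
  · rw [← xv, ← Finset.sum_neg_distrib, ← Finset.sum_range_reflect]
    apply Finset.sum_congr rfl
    intro i hi
    have := Finset.mem_range.1 hi
    beta_reduce
    rw [show n - (n - 1 - i + 1) = i by omega, show n - (n - 1 - i) = i + 1 by omega]
    ring

lemma Ch.sub {n : ℕ} (x : ℕ → X) (xs : ∀ i < n, dist (x i) (x (i + 1)) ≤ 1 / 3)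
    {i j : ℕ} (hij : i ≤ j) (hj : j ≤ n) :
    Ch f h (j - i) (x i) (x j)
      (∑ k ∈ range j, (f (x k) + f (x (k + 1))) / 2 * (h (x (k + 1)) - h (x k)) -
       ∑ k ∈ range i, (f (x k) + f (x (k + 1))) / 2 * (h (x (k + 1)) - h (x k))) := by
  obtain ⟨d, rfl⟩ := Nat.exists_eq_add_of_le hij
  refine ⟨fun k => x (i + k), by simp, by simp, ?_, ?_⟩
  · intro k hk
    exact xs (i + k) (by omega)
  · rw [Finset.sum_range_add]
    simp [add_assoc]

/-- sampling a 1-Lipschitz path -/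
lemma sample (c : ℝ → X) (s t : ℝ) (n : ℕ) (hn : 0 < n) (hst : |t - s| ≤ n / 3)
    (hc : ∀ u ∈ Set.uIcc s t, ∀ v ∈ Set.uIcc s t, dist (c u) (c v) ≤ |u - v|) :
    ∃ x : ℕ → X, x 0 = c s ∧ x n = c t ∧ (∀ i < n, dist (x i) (x (i + 1)) ≤ 1 / 3) ∧
      ∀ i ≤ n, ∃ u ∈ Set.uIcc s t, x i = c u := by
  have hn' : (0 : ℝ) < n := by exact_mod_cast hn
  have mem : ∀ i : ℕ, i ≤ n → s + (i / n : ℝ) * (t - s) ∈ Set.uIcc s t := by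
    intro i hi
    have h1 : (0 : ℝ) ≤ i / n := by positivity
    have h2 : (i / n : ℝ) ≤ 1 := by
      rw [div_le_one hn']; exact_mod_cast hi
    rcases le_total s t with hh | hh
    · rw [Set.uIcc_of_le hh]; constructor <;> nlinarith
    · rw [Set.uIcc_of_ge hh]; constructor <;> nlinarith
  refine ⟨fun i => c (s + (i / n : ℝ) * (t - s)), by simp, ?_, ?_, ?_⟩
  · simp [hn'.ne']
  · intro i hi
    refine (hc _ (mem i hi.le) _ (mem (i + 1) hi)).trans ?_
    have : s + (i / n : ℝ) * (t - s) - (s + ((i + 1 : ℕ) / n : ℝ) * (t - s)) = - ((t - s) / n) := by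
      push_cast; field_simp; ring
    rw [this, abs_neg, abs_div, abs_of_pos hn', div_le_iff₀ hn']
    linarith
  · intro i hi
    exact ⟨_, mem i hi, rfl⟩

lemma ch_const_h (c : ℝ → X) (s t k : ℝ) (n : ℕ) (hn : 0 < n) (hst : |t - s| ≤ n / 3)
    (hc : ∀ u ∈ Set.uIcc s t, ∀ v ∈ Set.uIcc s t, dist (c u) (c v) ≤ |u - v|)
    (hh : ∀ u ∈ Set.uIcc s t, h (c u) = k) : Ch f h n (c s) (c t) 0 := by
  obtain ⟨x, x0, xn, xs, xm⟩ := sample c s t n hn hst hc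
  refine ⟨x, x0, xn, xs, ?_⟩
  apply Finset.sum_eq_zero
  intro i hi
  have := Finset.mem_range.1 hi
  obtain ⟨u, hu, e⟩ := xm i this.le
  obtain ⟨v, hv, e'⟩ := xm (i + 1) this
  rw [e, e', hh u hu, hh v hv]; simp

lemma ch_const_f (c : ℝ → X) (s t k : ℝ) (n : ℕ) (hn : 0 < n) (hst : |t - s| ≤ n / 3)
    (hc : ∀ u ∈ Set.uIcc s t, ∀ v ∈ Set.uIcc s t, dist (c u) (c v) ≤ |u - v|)
    (hh : ∀ u ∈ Set.uIcc s t, f (c u) = k) :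
    Ch f h n (c s) (c t) (k * (h (c t) - h (c s))) := by
  obtain ⟨x, x0, xn, xs, xm⟩ := sample c s t n hn hst hc
  refine ⟨x, x0, xn, xs, ?_⟩
  rw [← x0, ← xn, ← Finset.sum_range_sub (fun i => h (x i)), Finset.mul_sum]
  apply Finset.sum_congr rfl
  intro i hi
  have := Finset.mem_range.1 hi
  obtain ⟨u, hu, e⟩ := xm i this.le
  obtain ⟨v, hv, e'⟩ := xm (i + 1) this
  rw [show f (x i) = k by rw [e, hh u hu], show f (x (i + 1)) = k by rw [e', hh v hv]]; ring

lemma geod_lip {g : ℝ → X} {p q : X} (hg : IsGeodesicFrom g p q) :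
    ∀ u ∈ Set.uIcc 0 (dist p q), ∀ v ∈ Set.uIcc 0 (dist p q), dist (g u) (g v) ≤ |u - v| := by
  rw [Set.uIcc_of_le dist_nonneg]
  intro u hu v hv
  exact (hg.2.2 u hu v hv).le

/-- some chain between two points -/
lemma ch_exists (hgeo : GeodesicSpace X) (p q : X) (n : ℕ) (hn : 0 < n) (hd : dist p q ≤ n / 3) :
    ∃ v, Ch f h n p q v := by
  obtain ⟨g, hg⟩ := hgeo p q
  obtain ⟨x, x0, xn, xs, xm⟩ := sample g 0 (dist p q) n hn
    (by rw [sub_zero, abs_of_nonneg dist_nonneg]; exact hd) (geod_lip hg)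
  exact ⟨_, x, x0.trans hg.1, xn.trans hg.2.1, xs, rfl⟩

lemma chain_dist {n : ℕ} (x : ℕ → X) (xs : ∀ i < n, dist (x i) (x (i + 1)) ≤ 1 / 3)
    {i j : ℕ} (hij : i ≤ j) (hj : j ≤ n) : dist (x i) (x j) ≤ ((j : ℝ) - i) / 3 := by
  induction j, hij using Nat.le_induction with
  | base => simp
  | succ j hij ih =>
    have h1 := ih (by omega)
    have h2 := xs j (by omega)
    have h3 := dist_triangle (x i) (x j) (x (j + 1))
    push_cast
    linarith

lemma loop_bound {n : ℕ} {p : X} {v : ℝ} (hf : ∀ a b, |f a - f b| ≤ dist a b)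
    (hh : ∀ a b, |h a - h b| ≤ dist a b) (hl : Ch f h n p p v) : v ≤ (n : ℝ) ^ 2 := by
  obtain ⟨x, x0, xn, xs, xv⟩ := hl
  have e : v = ∑ i ∈ range n,
      ((f (x i) + f (x (i + 1))) / 2 - f (x 0)) * (h (x (i + 1)) - h (x i)) := by
    have : ∑ i ∈ range n, f (x 0) * (h (x (i + 1)) - h (x i)) = 0 := by
      rw [← Finset.mul_sum, Finset.sum_range_sub (fun i => h (x i)), xn, x0]; simp
    rw [← xv, ← sub_zero (∑ i ∈ range n, _), ← this, ← Finset.sum_sub_distrib]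
    apply Finset.sum_congr rfl
    intro i hi; ring
  have b : ∀ i ∈ range n,
      ((f (x i) + f (x (i + 1))) / 2 - f (x 0)) * (h (x (i + 1)) - h (x i)) ≤ n := by
    intro i hi
    have hi := Finset.mem_range.1 hi
    have h1 : |f (x i) - f (x 0)| ≤ ((i : ℝ) - (0 : ℕ)) / 3 := (hf (x i) (x 0)).trans (by
      rw [dist_comm]; exact chain_dist x xs (Nat.zero_le i) hi.le)
    have h2 : |f (x (i + 1)) - f (x 0)| ≤ (((i + 1 : ℕ) : ℝ) - (0 : ℕ)) / 3 :=
      (hf (x (i + 1)) (x 0)).trans (by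
        rw [dist_comm]; exact chain_dist x xs (Nat.zero_le (i + 1)) hi)
    have h3 : |h (x (i + 1)) - h (x i)| ≤ 1 / 3 :=
      (hh (x (i + 1)) (x i)).trans (by rw [dist_comm]; exact xs i hi)
    have hi' : ((i + 1 : ℕ) : ℝ) ≤ n := by exact_mod_cast hi
    push_cast at h1 h2 hi'
    have h4 : |(f (x i) + f (x (i + 1))) / 2 - f (x 0)| ≤ n := by
      rw [abs_le] at *
      constructor <;> linarith [h1.1, h1.2, h2.1, h2.2, (Nat.cast_nonneg i : (0:ℝ) ≤ i)]
    calc _ ≤ |((f (x i) + f (x (i + 1))) / 2 - f (x 0)) * (h (x (i + 1)) - h (x i))| := le_abs_self _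
      _ = |(f (x i) + f (x (i + 1))) / 2 - f (x 0)| * |h (x (i + 1)) - h (x i)| := abs_mul _ _
      _ ≤ n * 1 := by
        apply mul_le_mul h4 (by linarith) (abs_nonneg _) (Nat.cast_nonneg _)
      _ = n := mul_one _
  rw [e]
  refine (Finset.sum_le_sum b).trans ?_
  simp [sq]

lemma le_of_sq_le_sq_aux {a b : ℝ} (hab : a ^ 2 ≤ b ^ 2) (hb : 0 ≤ b) : a ≤ b :=
  le_of_abs_le (by rw [← abs_of_nonneg hb]; exact sq_le_sq.1 hab)

/-- the superlinear gauge -/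
noncomputable def Φ (n : ℕ) : ℝ := n * √n

lemma Φ_split (n a d : ℕ) (hn : 200 ≤ n) (ha : 2 ≤ a) (han : 2 * a ≤ n) (hd : d = a / 11880 + 1) :
    Φ (a + d) + Φ (n - a + d) ≤ Φ n := by
  have hda : d < a := by omega
  have key : (a + d) ^ 3 ≤ (a - d) ^ 2 * n := by
    obtain ⟨e, rfl⟩ : ∃ e, a = d + e := ⟨a - d, by omega⟩
    simp only [Nat.add_sub_cancel_left]
    rcases le_or_gt 10 (d + e) with h10 | h10
    · have h1 : 9 * d ≤ e := by omega
      have h2 : 9 * (d + e + d) ≤ 11 * e := by omega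
      have h3 : 9 * n ≥ 18 * (d + e) := by omega
      have h4 : (9 * (d + e + d)) ^ 3 ≤ (11 * e) ^ 3 := Nat.pow_le_pow_left h2 3
      have h5 : e ^ 2 * (2 * e) ≤ e ^ 2 * n := Nat.mul_le_mul_left _ (by omega)
      have h6 : 729 * (d + e + d) ^ 3 ≤ 1331 * e ^ 3 := by
        calc _ = (9 * (d + e + d)) ^ 3 := by ring
          _ ≤ _ := h4
          _ = _ := by ring
      have h7 : e ^ 2 * (2 * e) = 2 * e ^ 3 := by ring
      omega
    · have hd1 : d = 1 := by omega
      subst hd1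
      have he : 1 ≤ e := by omega
      have he' : e ≤ 8 := by omega
      have : (1 + e + 1) ^ 3 ≤ e ^ 2 * 200 := by
        interval_cases e <;> norm_num
      exact this.trans (Nat.mul_le_mul_left _ hn)
  have keyR : ((a : ℝ) + d) ^ 3 ≤ ((a : ℝ) - d) ^ 2 * n := by
    have : (((a + d) ^ 3 : ℕ) : ℝ) ≤ (((a - d) ^ 2 * n : ℕ) : ℝ) := by exact_mod_cast key
    push_cast [Nat.cast_sub hda.le] at this
    exact this
  have hda' : (d : ℝ) ≤ a := by exact_mod_cast hda.le
  have h1 : ((a : ℝ) + d) * √((a : ℝ) + d) ≤ ((a : ℝ) - d) * √n := by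
    refine le_of_sq_le_sq_aux ?_ (mul_nonneg (by linarith) (Real.sqrt_nonneg _))
    rw [mul_pow, mul_pow, Real.sq_sqrt (by positivity), Real.sq_sqrt (by positivity)]
    calc _ = ((a : ℝ) + d) ^ 3 := by ring
      _ ≤ _ := keyR
  have h2 : Φ (n - a + d) ≤ ((n : ℝ) - a + d) * √n := by
    unfold Φ
    have hc : ((n - a + d : ℕ) : ℝ) = (n : ℝ) - a + d := by
      push_cast [Nat.cast_sub (show a ≤ n by omega)]; ring
    have hle : ((n - a + d : ℕ) : ℝ) ≤ n := by exact_mod_cast (by omega)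
    rw [← hc]
    exact mul_le_mul_of_nonneg_left (Real.sqrt_le_sqrt hle) (Nat.cast_nonneg _)
  have h3 : Φ (a + d) = ((a : ℝ) + d) * √((a : ℝ) + d) := by simp [Φ]
  rw [h3]
  have : Φ n = n * √n := rfl
  rw [this]
  nlinarith

/-- conclusion for a given `N` -/
def Goal (X : Type*) [MetricSpace X] (N : ℕ) : Prop :=
  ∃ n : ℕ, N ≤ n ∧ ∃ φ : ZMod n → X,
      ∀ x y : ZMod n,
        (1 / 17820) * (cycleDist x y : ℝ) ≤ dist (φ x) (φ y) ∧
        dist (φ x) (φ y) ≤ (cycleDist x y : ℝ)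

lemma cycleDist_le {m : ℕ} {x y : ZMod m} {k : ℕ}
    (hk : (k : ZMod m) = y - x ∨ (k : ZMod m) = x - y) : cycleDist x y ≤ k := Nat.sInf_le hk

lemma cycleDist_comm {m : ℕ} (x y : ZMod m) : cycleDist x y = cycleDist y x := by
  unfold cycleDist
  congr 1
  ext k
  exact or_comm

lemma lip_of_step {m : ℕ} (hm : 0 < m) (φ : ZMod m → X) (hφ : ∀ x, dist (φ x) (φ (x + 1)) ≤ 1)
    (x y : ZMod m) : dist (φ x) (φ y) ≤ cycleDist x y := by
  have : NeZero m := ⟨hm.ne'⟩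
  have step : ∀ (k : ℕ) (x : ZMod m), dist (φ x) (φ (x + k)) ≤ k := by
    intro k x
    induction k with
    | zero => simp
    | succ k ih =>
      have h1 := hφ (x + k)
      have h2 := dist_triangle (φ x) (φ (x + k)) (φ (x + k + 1))
      push_cast
      rw [← add_assoc]
      linarith
  have hne : {k : ℕ | (k : ZMod m) = y - x ∨ (k : ZMod m) = x - y}.Nonempty :=
    ⟨(y - x).val, Or.inl (by simp)⟩
  have := Nat.sInf_mem hne
  change ((cycleDist x y : ℕ) : ZMod m) = y - x ∨ ((cycleDist x y : ℕ) : ZMod m) = x - y at this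
  rcases this with e | e
  · have := step (cycleDist x y) x
    rwa [e, add_sub_cancel] at this
  · have := step (cycleDist x y) y
    rw [e, add_sub_cancel, dist_comm] at this
    exact this

/-- A closed chain without strong shortcuts gives the cycle. -/
lemma goal_of_chain (N n : ℕ) (hn : 2 * N + 2 ≤ n) (x : ℕ → X) (xn : x n = x 0)
    (xs : ∀ i < n, dist (x i) (x (i + 1)) ≤ 1 / 3)
    (ns : ∀ i j a : ℕ, i < j → j ≤ n → 2 ≤ a → a ≤ j - i → a ≤ n - (j - i) →
      (a = j - i ∨ a = n - (j - i)) → (a : ℝ) / 2 / 17820 ≤ dist (x i) (x j)) :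
    Goal X N := by
  obtain ⟨m, hm⟩ : ∃ m, m = n / 2 := ⟨_, rfl⟩
  have hm0 : 0 < m := by omega
  have : NeZero m := ⟨hm0.ne'⟩
  have main : ∀ u v : ZMod m, u.val < v.val →
      (1 / 17820) * (cycleDist u v : ℝ) ≤ dist (x (2 * u.val)) (x (2 * v.val)) := by
    intro u v huv
    have hv := v.val_lt
    have c1 : cycleDist u v ≤ v.val - u.val := cycleDist_le (Or.inl (by
      rw [Nat.cast_sub huv.le]; simp))
    have c2 : cycleDist u v ≤ m - (v.val - u.val) := cycleDist_le (Or.inr (by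
      rw [Nat.cast_sub (by omega), Nat.cast_sub huv.le]; simp))
    have hlen : 2 * v.val - 2 * u.val ≤ n := by omega
    have h2 := ns (2 * u.val) (2 * v.val)
      (min (2 * v.val - 2 * u.val) (n - (2 * v.val - 2 * u.val)))
      (by omega) (by omega) (by omega) (by omega) (by omega) (by omega)
    have h3 : 2 * cycleDist u v ≤ min (2 * v.val - 2 * u.val) (n - (2 * v.val - 2 * u.val)) := by
      omega
    have h4 : (2 * (cycleDist u v) : ℝ) ≤
        ((min (2 * v.val - 2 * u.val) (n - (2 * v.val - 2 * u.val)) : ℕ) : ℝ) := by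
      exact_mod_cast h3
    linarith
  refine ⟨m, by omega, fun u => x (2 * u.val), fun u v => ⟨?_, ?_⟩⟩
  · rcases lt_trichotomy u.val v.val with hl | he | hg
    · exact main u v hl
    · have : u = v := ZMod.val_injective m he
      subst this
      have : cycleDist u u ≤ 0 := cycleDist_le (by simp)
      have h0 : cycleDist u u = 0 := by omega
      simp [h0]
    · have := main v u hg
      rw [dist_comm, cycleDist_comm]; exact this
  · refine lip_of_step hm0 (fun u => x (2 * u.val)) ?_ u v
    intro u
    have hu := u.val_lt
    rcases lt_or_ge (u.val + 1) m with hl | hg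
    · have e : (u + 1).val = u.val + 1 := by
        have : (u + 1) = ((u.val + 1 : ℕ) : ZMod m) := by simp
        rw [this, ZMod.val_natCast, Nat.mod_eq_of_lt hl]
      simp only [e]
      have := chain_dist x xs (show 2 * u.val ≤ 2 * (u.val + 1) by omega) (by omega)
      push_cast at this
      linarith
    · have e : (u + 1) = 0 := by
        have h1 : u.val + 1 = m := by omega
        have : (u + 1) = ((u.val + 1 : ℕ) : ZMod m) := by simp
        rw [this, h1]; simp
      simp only [e, ZMod.val_zero, mul_zero]
      rw [← xn]
      have := chain_dist x xs (show 2 * u.val ≤ n by omega) le_rfl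
      have h2 : (n : ℝ) ≤ 2 * (u.val : ℝ) + 3 := by exact_mod_cast (by omega)
      push_cast at this
      linarith

/-- A closed chain with large integral gives the cycle. -/
lemma goal_of_loop (hgeo : GeodesicSpace X) (hf : ∀ a b, |f a - f b| ≤ dist a b)
    (hh : ∀ a b, |h a - h b| ≤ dist a b) (N n₀ : ℕ) (p₀ : X) (v₀ : ℝ)
    (hl : Ch f h n₀ p₀ p₀ v₀) (hv : √((2 * N + 200 : ℕ) : ℝ) * Φ n₀ < v₀) : Goal X N := by
  classical
  set ε := √((2 * N + 200 : ℕ) : ℝ) with hε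
  have hε0 : 0 ≤ ε := Real.sqrt_nonneg _
  have hex : ∃ n, ∃ p v, Ch f h n p p v ∧ ε * Φ n < v := ⟨n₀, p₀, v₀, hl, hv⟩
  obtain ⟨n, ⟨p, v, hc, hev⟩, hmin⟩ : ∃ n, (∃ p v, Ch f h n p p v ∧ ε * Φ n < v) ∧
      ∀ k < n, ¬ ∃ p v, Ch f h k p p v ∧ ε * Φ k < v :=
    ⟨Nat.find hex, Nat.find_spec hex, fun k hk => Nat.find_min hex hk⟩
  have hb := loop_bound hf hh hc
  have hnbig : 2 * N + 200 ≤ n := by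
    by_contra hlt
    push Not at hlt
    have h1 : √(n : ℝ) ≤ ε := Real.sqrt_le_sqrt (by exact_mod_cast hlt.le)
    have h2 : (n : ℝ) ^ 2 = √n * (n * √n) := by
      have := Real.mul_self_sqrt (Nat.cast_nonneg n : (0 : ℝ) ≤ n)
      calc (n : ℝ) ^ 2 = n * (√n * √n) := by rw [this]; ring
        _ = _ := by ring
    have h3 : √n * (n * √n) ≤ ε * (n * √n) := mul_le_mul_of_nonneg_right h1 (by positivity)
    have : Φ n = n * √n := rfl
    rw [this] at hev
    linarith
  obtain ⟨x, x0, xn, xs, xv⟩ := hc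
  refine goal_of_chain N n (by omega) x (by rw [xn, x0]) xs ?_
  intro i j a hij hj ha ha1 ha2 hae
  by_contra hlt
  push Not at hlt
  obtain ⟨d, hd⟩ : ∃ d, d = a / 11880 + 1 := ⟨_, rfl⟩
  have hdd : dist (x i) (x j) ≤ d / 3 := by
    have : a ≤ 11880 * d := by omega
    have : (a : ℝ) ≤ 11880 * d := by exact_mod_cast this
    linarith
  obtain ⟨u, hu⟩ := ch_exists (f := f) (h := h) hgeo (x i) (x j) d (by omega) hdd
  have L1 := (Ch.sub (f := f) (h := h) x xs hij.le hj).trans hu.symm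
  have L2 := ((Ch.sub (f := f) (h := h) x xs (Nat.zero_le i) (by omega)).trans hu).trans
    (Ch.sub (f := f) (h := h) x xs hj le_rfl)
  rw [xn, x0] at L2
  have m1 := hmin (j - i + d) (by omega)
  have m2 := hmin (i - 0 + d + (n - j)) (by omega)
  push Not at m1 m2
  have b1 := m1 _ _ L1
  have b2 := m2 _ _ L2
  rw [xv] at b2
  have hs : Φ (j - i + d) + Φ (i - 0 + d + (n - j)) ≤ Φ n := by
    have hsp := Φ_split n a d (by omega) ha (by omega) hd
    rcases hae with e | e
    · rw [show j - i + d = a + d by omega, show i - 0 + d + (n - j) = n - a + d by omega]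
      exact hsp
    · rw [show j - i + d = n - a + d by omega, show i - 0 + d + (n - j) = a + d by omega, add_comm]
      exact hsp
  have := mul_le_mul_of_nonneg_left hs hε0
  simp only [Finset.range_zero, Finset.sum_empty] at b2
  linarith


lemma morse (hgeo : GeodesicSpace X) (N : ℕ) (c g : ℝ → X) (T ℓ : ℝ) (hT : 0 ≤ T) (hℓ : 0 ≤ ℓ)
    (hlip : ∀ u ∈ Set.Icc 0 T, ∀ v ∈ Set.Icc 0 T, dist (c u) (c v) ≤ |u - v|)
    (hq : ∀ u ∈ Set.Icc 0 T, ∀ v ∈ Set.Icc 0 T, |u - v| ≤ 3 * dist (c u) (c v))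
    (hg : ∀ u ∈ Set.Icc 0 ℓ, ∀ v ∈ Set.Icc 0 ℓ, dist (g u) (g v) = |u - v|)
    (g0 : g 0 = c 0) (gT : g ℓ = c T) (t1 : ℝ) (ht1 : t1 ∈ Set.Icc 0 T)
    (hR : (10 : ℝ) ^ 8 * ((2 * N + 200 : ℕ) : ℝ) ≤ Metric.infDist (c t1) (g '' Set.Icc 0 ℓ)) :
    Goal X N := by
  set G := g '' Set.Icc 0 ℓ with hG
  have gcont : ContinuousOn g (Set.Icc 0 ℓ) := by
    apply LipschitzOnWith.continuousOn (K := 1)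
    apply LipschitzOnWith.of_dist_le_mul
    intro u hu v hv
    rw [hg u hu v hv, Real.dist_eq]; simp
  have ccont : ContinuousOn c (Set.Icc 0 T) := by
    apply LipschitzOnWith.continuousOn (K := 1)
    apply LipschitzOnWith.of_dist_le_mul
    intro u hu v hv
    have := hlip u hu v hv
    rw [Real.dist_eq]; simpa using this
  have Gcomp : IsCompact G := isCompact_Icc.image_of_continuousOn gcont
  have Gne : G.Nonempty := ⟨g 0, 0, ⟨le_rfl, hℓ⟩, rfl⟩
  have c0G : c 0 ∈ G := ⟨0, ⟨le_rfl, hℓ⟩, g0⟩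
  have cTG : c T ∈ G := ⟨ℓ, ⟨hℓ, le_rfl⟩, gT⟩
  obtain ⟨t0, ht0, hmax⟩ := isCompact_Icc.exists_isMaxOn ⟨t1, ht1⟩
    ((Metric.continuous_infDist_pt G).comp_continuousOn ccont)
  obtain ⟨D, hD⟩ : ∃ D, D = Metric.infDist (c t0) G := ⟨_, rfl⟩
  have hmax' : ∀ t ∈ Set.Icc 0 T, Metric.infDist (c t) G ≤ D := by
    intro t ht; rw [hD]; exact hmax ht
  have hDR : (10 : ℝ) ^ 8 * ((2 * N + 200 : ℕ) : ℝ) ≤ D := hR.trans (hmax' t1 ht1)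
  have hM : (200 : ℝ) ≤ ((2 * N + 200 : ℕ) : ℝ) := by exact_mod_cast (by omega)
  have hD0 : 1 ≤ D := by linarith
  have hdG : ∀ p ∈ G, D ≤ dist (c t0) p := fun p hp => by
    rw [hD]; exact Metric.infDist_le_dist_of_mem hp
  have z0 : (0 : ℝ) ∈ Set.Icc 0 T := ⟨le_rfl, hT⟩
  have zT : T ∈ Set.Icc 0 T := ⟨hT, le_rfl⟩
  have t0D : D ≤ t0 := by
    have h1 := hdG _ c0G
    have h2 := hlip t0 ht0 0 z0
    rw [sub_zero, abs_of_nonneg ht0.1] at h2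
    linarith
  have TD : D ≤ T - t0 := by
    have h1 := hdG _ cTG
    have h2 := hlip t0 ht0 T zT
    rw [abs_sub_comm, abs_of_nonneg (by linarith [ht0.2])] at h2
    linarith
  obtain ⟨α, hα⟩ : ∃ α, α = max 0 (t0 - 4 * D) := ⟨_, rfl⟩
  obtain ⟨β, hβ⟩ : ∃ β, β = min T (t0 + 4 * D) := ⟨_, rfl⟩
  have α0 : 0 ≤ α := hα ▸ le_max_left _ _
  have α1 : t0 - 4 * D ≤ α := hα ▸ le_max_right _ _
  have α2 : α ≤ t0 - D := by rw [hα]; exact max_le (by linarith) (by linarith)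
  have β0 : β ≤ T := hβ ▸ min_le_left _ _
  have β1 : β ≤ t0 + 4 * D := hβ ▸ min_le_right _ _
  have β2 : t0 + D ≤ β := by rw [hβ]; exact le_min (by linarith) (by linarith)
  have αm : α ∈ Set.Icc 0 T := ⟨α0, by linarith⟩
  have βm : β ∈ Set.Icc 0 T := ⟨by linarith, β0⟩
  obtain ⟨y', hy'G, hy'⟩ := Gcomp.exists_infDist_eq_dist Gne (c α)
  obtain ⟨z', hz'G, hz'⟩ := Gcomp.exists_infDist_eq_dist Gne (c β)
  have ryD : dist (c α) y' ≤ D := hy' ▸ hmax' α αm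
  have rzD : dist (c β) z' ≤ D := hz' ▸ hmax' β βm
  have ry : dist (c α) y' ≤ (t0 - D / 2 - α) / 3 := by
    rcases le_total (t0 - 4 * D) 0 with hh | hh
    · have : α = 0 := by rw [hα]; exact max_eq_left hh
      rw [← hy', this, Metric.infDist_zero_of_mem c0G]; linarith
    · have : α = t0 - 4 * D := by rw [hα]; exact max_eq_right hh
      linarith
  have rz : dist (c β) z' ≤ (β - (t0 + D / 2)) / 3 := by
    rcases le_total T (t0 + 4 * D) with hh | hh
    · have : β = T := by rw [hβ]; exact min_eq_left hh
      rw [← hz', this, Metric.infDist_zero_of_mem cTG]; linarith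
    · have : β = t0 + 4 * D := by rw [hβ]; exact min_eq_right hh
      linarith
  let A : Set X := {p | ∃ σ ∈ Set.Icc 0 T, dist p (c σ) ≤ (t0 - D / 2 - σ) / 3}
  let f : X → ℝ := fun p => min (Metric.infDist p G) (D / 2)
  let h : X → ℝ := fun p => min (Metric.infDist p A) (D / 3)
  have lipmin : ∀ (S : Set X) (k : ℝ) (a b : X),
      |min (Metric.infDist a S) k - min (Metric.infDist b S) k| ≤ dist a b := by
    intro S k a b
    have h1 : Metric.infDist a S ≤ Metric.infDist b S + dist a b :=
      Metric.infDist_le_infDist_add_dist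
    have h2 : Metric.infDist b S ≤ Metric.infDist a S + dist b a :=
      Metric.infDist_le_infDist_add_dist
    rw [dist_comm b a] at h2
    have h3 : (0 : ℝ) ≤ dist a b := dist_nonneg
    rw [abs_le]
    constructor
    · rcases min_cases (Metric.infDist a S) k with ⟨e, _⟩ | ⟨e, _⟩ <;>
      rcases min_cases (Metric.infDist b S) k with ⟨e', _⟩ | ⟨e', _⟩ <;> rw [e, e'] <;> linarith
    · rcases min_cases (Metric.infDist a S) k with ⟨e, _⟩ | ⟨e, _⟩ <;>
      rcases min_cases (Metric.infDist b S) k with ⟨e', _⟩ | ⟨e', _⟩ <;> rw [e, e'] <;> linarith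
  have hf : ∀ a b, |f a - f b| ≤ dist a b := fun a b => lipmin G (D / 2) a b
  have hh : ∀ a b, |h a - h b| ≤ dist a b := fun a b => lipmin A (D / 3) a b
  have Ane : A.Nonempty := ⟨c (t0 - D / 2), t0 - D / 2, ⟨by linarith, by linarith⟩, by simp⟩
  have hA : ∀ p ∈ A, h p = 0 := by
    intro p hp
    simp only [h]
    rw [Metric.infDist_zero_of_mem hp]
    exact min_eq_left (by linarith)
  have hB : ∀ p, (∃ σ ∈ Set.Icc 0 T, dist p (c σ) ≤ (σ - (t0 + D / 2)) / 3) → h p = D / 3 := by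
    rintro p ⟨σ, hσ, hp⟩
    apply min_eq_right
    rw [Metric.le_infDist Ane]
    rintro q ⟨τ, hτ, hqq⟩
    have h1 := hq σ hσ τ hτ
    have h2 := le_abs_self (σ - τ)
    have h3 := dist_triangle4 (c σ) p q (c τ)
    rw [dist_comm (c σ) p] at h3
    linarith
  have fG : ∀ p ∈ G, f p = 0 := by
    intro p hp
    simp only [f]
    rw [Metric.infDist_zero_of_mem hp]
    exact min_eq_left (by linarith)
  obtain ⟨k, hk⟩ : ∃ k : ℕ, k = ⌈D⌉₊ := ⟨_, rfl⟩
  have hk1 : D ≤ k := hk ▸ Nat.le_ceil D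
  have hk2 : (k : ℝ) ≤ 2 * D := by
    have := Nat.ceil_lt_add_one (show 0 ≤ D by linarith)
    rw [← hk] at this; linarith
  have hk0 : 0 < k := by
    have : (0 : ℝ) < k := by linarith
    exact_mod_cast this
  have lipsub : ∀ s t, s ∈ Set.Icc 0 T → t ∈ Set.Icc 0 T →
      ∀ u ∈ Set.uIcc s t, ∀ v ∈ Set.uIcc s t, dist (c u) (c v) ≤ |u - v| := by
    intro s t hs ht u hu v hv
    exact hlip u (Set.uIcc_subset_Icc hs ht hu) v (Set.uIcc_subset_Icc hs ht hv)
  have pm : t0 - D / 2 ∈ Set.Icc 0 T := ⟨by linarith, by linarith⟩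
  have pp : t0 + D / 2 ∈ Set.Icc 0 T := ⟨by linarith, by linarith⟩
  have s1 : Ch f h (12 * k) (c α) (c (t0 - D / 2)) 0 := by
    apply ch_const_h c α (t0 - D / 2) 0 (12 * k) (by omega) _ (lipsub _ _ αm pm)
    · intro u hu
      have hu' := Set.uIcc_subset_Icc αm pm hu
      rw [Set.uIcc_of_le (by linarith)] at hu
      exact hA _ ⟨u, hu', by rw [dist_self]; linarith [hu.2]⟩
    · rw [abs_of_nonneg (by linarith)]; push_cast; linarith
  have s2 : Ch f h (3 * k) (c (t0 - D / 2)) (c (t0 + D / 2)) (D / 2 * (D / 3 - 0)) := by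
    have e1 : h (c (t0 - D / 2)) = 0 := hA _ ⟨_, pm, by simp⟩
    have e2 : h (c (t0 + D / 2)) = D / 3 := hB _ ⟨_, pp, by simp⟩
    rw [← e1, ← e2]
    have := ch_const_f (f := f) (h := h) c (t0 - D / 2) (t0 + D / 2) (D / 2) (3 * k) (by omega)
      (by rw [abs_of_nonneg (by linarith)]; push_cast; linarith) (lipsub _ _ pm pp) (by
        intro u hu
        have hu' := Set.uIcc_subset_Icc pm pp hu
        rw [Set.uIcc_of_le (by linarith)] at hu
        apply min_eq_right
        have h1 : Metric.infDist (c t0) G ≤ Metric.infDist (c u) G + dist (c t0) (c u) :=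
          Metric.infDist_le_infDist_add_dist
        have h2 := hlip t0 ht0 u hu'
        have h3 : |t0 - u| ≤ D / 2 := by
          rw [abs_le]; constructor <;> linarith [hu.1, hu.2]
        rw [← hD] at h1
        linarith)
    rw [e1, e2] at this ⊢
    exact this
  have s3 : Ch f h (12 * k) (c (t0 + D / 2)) (c β) 0 := by
    apply ch_const_h c (t0 + D / 2) β (D / 3) (12 * k) (by omega) _ (lipsub _ _ pp βm)
    · intro u hu
      have hu' := Set.uIcc_subset_Icc pp βm hu
      rw [Set.uIcc_of_le (by linarith)] at hu
      exact hB _ ⟨u, hu', by rw [dist_self]; linarith [hu.1]⟩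
    · rw [abs_of_nonneg (by linarith)]; push_cast; linarith
  have s4 : Ch f h (3 * k) (c β) z' 0 := by
    obtain ⟨γ, hγ⟩ := hgeo (c β) z'
    have := ch_const_h (f := f) (h := h) γ 0 (dist (c β) z') (D / 3) (3 * k) (by omega)
      (by rw [sub_zero, abs_of_nonneg dist_nonneg]; push_cast; linarith) (geod_lip hγ) (by
        intro u hu
        rw [Set.uIcc_of_le dist_nonneg] at hu
        refine hB _ ⟨β, βm, ?_⟩
        have h1 := hγ.2.2 u hu 0 ⟨le_rfl, dist_nonneg⟩
        rw [hγ.1, sub_zero, abs_of_nonneg hu.1] at h1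
        linarith [hu.2])
    rwa [hγ.1, hγ.2.1] at this
  have s6 : Ch f h (3 * k) (c α) y' 0 := by
    obtain ⟨γ, hγ⟩ := hgeo (c α) y'
    have := ch_const_h (f := f) (h := h) γ 0 (dist (c α) y') 0 (3 * k) (by omega)
      (by rw [sub_zero, abs_of_nonneg dist_nonneg]; push_cast; linarith) (geod_lip hγ) (by
        intro u hu
        rw [Set.uIcc_of_le dist_nonneg] at hu
        refine hA _ ⟨α, αm, ?_⟩
        have h1 := hγ.2.2 u hu 0 ⟨le_rfl, dist_nonneg⟩
        rw [hγ.1, sub_zero, abs_of_nonneg hu.1] at h1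
        linarith [hu.2])
    rwa [hγ.1, hγ.2.1] at this
  have s5 : Ch f h (30 * k) z' y' 0 := by
    obtain ⟨a, ha, rfl⟩ := hz'G
    obtain ⟨b, hb, rfl⟩ := hy'G
    have hab : |b - a| ≤ 10 * D := by
      have h1 := hg b hb a ha
      have h2 := dist_triangle4 (g b) (c α) (c β) (g a)
      have h3 := hlip α αm β βm
      rw [abs_sub_comm, abs_of_nonneg (by linarith : (0:ℝ) ≤ β - α)] at h3
      rw [dist_comm (g b) (c α)] at h2
      linarith
    have := ch_const_f (f := f) (h := h) g a b 0 (30 * k) (by omega)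
      (by push_cast; linarith) (by
        intro u hu v hv
        exact (hg u (Set.uIcc_subset_Icc ha hb hu) v (Set.uIcc_subset_Icc ha hb hv)).le) (by
        intro u hu
        exact fG _ ⟨u, Set.uIcc_subset_Icc ha hb hu, rfl⟩)
    rwa [zero_mul] at this
  have loop := ((((s1.trans s2).trans s3).trans s4).trans s5).trans s6.symm
  refine goal_of_loop hgeo hf hh N _ _ _ loop ?_
  rw [show 12 * k + 3 * k + 12 * k + 3 * k + 30 * k + 3 * k = 63 * k by ring]
  have hn0 : ((63 * k : ℕ) : ℝ) ≤ 126 * D := by push_cast; linarith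
  generalize 63 * k = n at hn0
  generalize ((2 * N + 200 : ℕ) : ℝ) = M at hDR hM
  have hrhs : (0 + D / 2 * (D / 3 - 0) + 0 + 0 + 0 + -0) = D ^ 2 / 6 := by ring
  rw [hrhs]
  apply lt_of_pow_lt_pow_left₀ 2 (by positivity)
  unfold Φ
  rw [mul_pow, mul_pow, Real.sq_sqrt (by linarith), Real.sq_sqrt (by positivity)]
  have h3 : (n : ℝ) ^ 3 ≤ (126 * D) ^ 3 := pow_le_pow_left₀ (Nat.cast_nonneg _) hn0 3
  have hD3 : 0 < D ^ 3 := by positivity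
  have h5 : 10 ^ 8 * M * D ^ 3 ≤ D * D ^ 3 := mul_le_mul_of_nonneg_right hDR hD3.le
  have h6 : M * (n : ℝ) ^ 3 ≤ M * (126 * D) ^ 3 := mul_le_mul_of_nonneg_left h3 (by linarith)
  have h7 : 0 < M * D ^ 3 := by positivity
  calc M * ((n : ℝ) ^ 2 * n) = M * (n : ℝ) ^ 3 := by ring
    _ ≤ M * (126 * D) ^ 3 := h6
    _ = 2000376 * (M * D ^ 3) := by ring
    _ < (10 ^ 8 * M * D ^ 3) / 36 := by nlinarith
    _ ≤ (D * D ^ 3) / 36 := by linarith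
    _ = (D ^ 2 / 6) ^ 2 := by ring

/-- Half of a triangle: from `x` along `[x,y]` to the point nearest to `z`, then to `z`. -/
lemma half (hgeo : GeodesicSpace X) (N : ℕ) (x y z : X) (gxy gxz : ℝ → X)
    (hxy : IsGeodesicFrom gxy x y) (hxz : IsGeodesicFrom gxz x z) (μ t : ℝ)
    (hμ : μ ∈ Set.Icc 0 (dist x y)) (ht : t ∈ Set.Icc 0 μ)
    (hnear : ∀ s ∈ Set.Icc 0 (dist x y), dist z (gxy μ) ≤ dist z (gxy s))
    (hR : (10 : ℝ) ^ 8 * ((2 * N + 200 : ℕ) : ℝ) ≤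
      Metric.infDist (gxy t) (gxz '' Set.Icc 0 (dist x z))) : Goal X N := by
  obtain ⟨γ, hγ⟩ := hgeo (gxy μ) z
  obtain ⟨r, hr⟩ : ∃ r, r = dist (gxy μ) z := ⟨_, rfl⟩
  have hr0 : 0 ≤ r := hr ▸ dist_nonneg
  obtain ⟨γ0, γ1, γi⟩ := hγ
  rw [← hr] at γ1 γi
  let c : ℝ → X := fun u => if u ≤ μ then gxy u else γ (u - μ)
  have c1 : ∀ u ≤ μ, c u = gxy u := fun u hu => by simp [c, hu]
  have c2 : ∀ u, μ ≤ u → c u = γ (u - μ) := fun u hu => by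
    rcases hu.eq_or_lt with rfl | hu
    · simp [c, γ0]
    · simp [c, not_le.2 hu]
  have mixed : ∀ u ∈ Set.Icc 0 (μ + r), ∀ v ∈ Set.Icc 0 (μ + r), u ≤ v →
      dist (c u) (c v) ≤ |u - v| ∧ |u - v| ≤ 3 * dist (c u) (c v) := by
    intro u hu v hv huv
    rcases le_total v μ with h1 | h1
    · rw [c1 u (huv.trans h1), c1 v h1,
        hxy.2.2 u ⟨hu.1, by linarith [hμ.2]⟩ v ⟨hv.1, by linarith [hμ.2]⟩]
      exact ⟨le_rfl, by linarith [abs_nonneg (u - v)]⟩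
    · rcases le_total μ u with h2 | h2
      · rw [c2 u h2, c2 v h1, γi (u - μ) ⟨by linarith, by linarith [hu.2]⟩ (v - μ)
          ⟨by linarith, by linarith [hv.2]⟩, show u - μ - (v - μ) = u - v by ring]
        exact ⟨le_rfl, by linarith [abs_nonneg (u - v)]⟩
      · rw [c1 u h2, c2 v h1]
        have e1 := hxy.2.2 u ⟨hu.1, by linarith [hμ.2]⟩ μ hμ
        have e2 := γi 0 ⟨le_rfl, hr0⟩ (v - μ) ⟨by linarith, by linarith [hv.2]⟩
        have e3 := γi (v - μ) ⟨by linarith, by linarith [hv.2]⟩ r ⟨hr0, le_rfl⟩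
        rw [abs_sub_comm, abs_of_nonneg (by linarith [hv.2])] at e1 e2 e3
        rw [γ0] at e2
        rw [γ1] at e3
        have e4 := hnear u ⟨hu.1, by linarith [hμ.2]⟩
        rw [dist_comm z, dist_comm z, ← hr] at e4
        rw [abs_sub_comm, abs_of_nonneg (by linarith)]
        have t1 := dist_triangle (gxy u) (gxy μ) (γ (v - μ))
        have t2 := dist_triangle (gxy u) (γ (v - μ)) z
        have t3 := dist_triangle (gxy u) (γ (v - μ)) (gxy μ)
        rw [dist_comm (γ (v - μ)) (gxy μ)] at t3
        constructor <;> linarith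
  have mixed' : ∀ u ∈ Set.Icc 0 (μ + r), ∀ v ∈ Set.Icc 0 (μ + r),
      dist (c u) (c v) ≤ |u - v| ∧ |u - v| ≤ 3 * dist (c u) (c v) := by
    intro u hu v hv
    rcases le_total u v with h1 | h1
    · exact mixed u hu v hv h1
    · rw [dist_comm, abs_sub_comm]; exact mixed v hv u hu h1
  refine morse hgeo N c gxz (μ + r) (dist x z) (by linarith [hμ.1]) dist_nonneg
    (fun u hu v hv => (mixed' u hu v hv).1) (fun u hu v hv => (mixed' u hu v hv).2) hxz.2.2
    ?_ ?_ t ⟨ht.1, by linarith [ht.2]⟩ ?_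
  · rw [c1 0 hμ.1, hxz.1, hxy.1]
  · rw [c2 _ (by linarith), add_sub_cancel_left, hxz.2.1, γ1]
  · rw [c1 t ht.2]; exact hR

lemma rev_geod {g : ℝ → X} {x y : X} (hg : IsGeodesicFrom g x y) :
    IsGeodesicFrom (fun t => g (dist x y - t)) y x := by
  obtain ⟨h0, h1, h2⟩ := hg
  refine ⟨by simpa using h1, by simpa [dist_comm y x] using h0, ?_⟩
  rw [dist_comm y x]
  intro s hs t ht
  rw [h2 _ ⟨by linarith [hs.2], by linarith [hs.1]⟩ _ ⟨by linarith [ht.2], by linarith [ht.1]⟩,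
    abs_sub_comm]
  congr 1; ring

lemma main (hgeo : GeodesicSpace X) (hnot : ¬ ∃ δ : ℝ, 0 ≤ δ ∧ RipsHyperbolic X δ) (N : ℕ) :
    Goal X N := by
  by_contra hgoal
  apply hnot
  refine ⟨(10 : ℝ) ^ 8 * ((2 * N + 200 : ℕ) : ℝ), by positivity, ?_⟩
  intro x y z gxy gxz gyz hxy hxz hyz p hp
  by_contra hlt
  push Not at hlt
  apply hgoal
  obtain ⟨t, ht, rfl⟩ := hp
  have gcont : ContinuousOn gxy (Set.Icc 0 (dist x y)) := by
    apply LipschitzOnWith.continuousOn (K := 1)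
    apply LipschitzOnWith.of_dist_le_mul
    intro u hu v hv
    rw [hxy.2.2 u hu v hv, Real.dist_eq]; simp
  obtain ⟨μ, hμ, hmin⟩ := isCompact_Icc.exists_isMinOn ⟨t, ht⟩
    (f := fun s => dist z (gxy s)) ((continuous_const.dist continuous_id).comp_continuousOn gcont)
  have hnear : ∀ s ∈ Set.Icc 0 (dist x y), dist z (gxy μ) ≤ dist z (gxy s) :=
    fun s hs => hmin hs
  rcases le_total t μ with h1 | h1
  · refine half hgeo N x y z gxy gxz hxy hxz μ t hμ ⟨ht.1, h1⟩ hnear ?_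
    exact hlt.le.trans (Metric.infDist_le_infDist_of_subset Set.subset_union_left
      ⟨gxz 0, 0, ⟨le_rfl, dist_nonneg⟩, rfl⟩)
  · refine half hgeo N y x z _ gyz (rev_geod hxy) hyz (dist x y - μ) (dist x y - t) ?_ ?_ ?_ ?_
    · rw [dist_comm y x]; exact ⟨by linarith [hμ.2], by linarith [hμ.1]⟩
    · exact ⟨by linarith [ht.2], by linarith⟩
    · rw [dist_comm y x]
      intro s hs
      simp only [sub_sub_cancel]
      exact hnear _ ⟨by linarith [hs.2], by linarith [hs.1]⟩
    · simp only [sub_sub_cancel]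
      exact hlt.le.trans (Metric.infDist_le_infDist_of_subset Set.subset_union_right
        ⟨gyz 0, 0, ⟨le_rfl, dist_nonneg⟩, rfl⟩)

end NHEC

/-- Let `(X,d)` be a geodesic space that is not hyperbolic.  Then there are arbitrarily
large integers `n` and maps `φₙ : Cₙ → X` with
`(1/17820)·d(x,y) ≤ d(φₙ x, φₙ y) ≤ d(x,y)` for all `x, y ∈ Cₙ`. -/
theorem non_hyperbolic_embedded_cycles
    {X : Type*} [MetricSpace X] (hgeo : GeodesicSpace X)
    (hnot : ¬ ∃ δ : ℝ, 0 ≤ δ ∧ RipsHyperbolic X δ) :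
    ∀ N : ℕ, ∃ n : ℕ, N ≤ n ∧ ∃ φ : ZMod n → X,
      ∀ x y : ZMod n,
        (1 / 17820) * (cycleDist x y : ℝ) ≤ dist (φ x) (φ y) ∧
        dist (φ x) (φ y) ≤ (cycleDist x y : ℝ) := by
  exact fun N => NHEC.main hgeo hnot N
end
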